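/- Let d be a positive rational with 1.5 < √d < 2 and √d irrational, with convergent denominators qₖ and differences βₖ for the continued fraction of √d. Let f : ℕ√d → ℝ be the function mapping n√d to Σ_k b_{k+1}·βₖ, where Σ_k b_{k+1}·qₖ is the Ostrowski representation of n. Then the restriction of λ_√d (the map x ↦ √d·x) to the set f(ℕ√d) is first-order definable without parameters in the structure R_√d = (ℝ; <, +, ℤ, ℤ√d); that is, the set {(f(n√d), √d·f(n√d)) : n ∈ ℕ} ⊆ ℝ² is definable in R_√d. -/

import Mathlib

open Real

/-- The sequence of complete quotients of `a`: `ζ₀ = a`, `ζ_{k+1} = 1/(ζₖ - ⌊ζₖ⌋)`. -/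
noncomputable def cfZeta (a : ℝ) : ℕ → ℝ
  | 0 => a
  | k + 1 => (cfZeta a k - ⌊cfZeta a k⌋)⁻¹

/-- The partial quotients of the continued fraction expansion `[a₀; a₁, a₂, …]` of `a`. -/
noncomputable def cfA (a : ℝ) (k : ℕ) : ℤ := ⌊cfZeta a k⌋

/-- Denominators of the convergents, shifted by one: `cfQ a (k+1) = qₖ`, with
`q₋₁ = 0`, `q₀ = 1` and `q_{k+1} = a_{k+1}·qₖ + q_{k-1}`. -/
noncomputable def cfQ (a : ℝ) : ℕ → ℤ
  | 0 => 0
  | 1 => 1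
  | k + 2 => cfA a (k + 1) * cfQ a (k + 1) + cfQ a k

/-- Numerators of the convergents, shifted by one: `cfP a (k+1) = pₖ`, with
`p₋₁ = 1`, `p₀ = a₀` and `p_{k+1} = a_{k+1}·pₖ + p_{k-1}`. -/
noncomputable def cfP (a : ℝ) : ℕ → ℤ
  | 0 => 1
  | 1 => cfA a 0
  | k + 2 => cfA a (k + 1) * cfP a (k + 1) + cfP a k

/-- The `k`-th difference `βₖ = qₖ·a − pₖ`. -/
noncomputable def cfBeta (a : ℝ) (k : ℕ) : ℝ := (cfQ a (k + 1) : ℝ) * a - (cfP a (k + 1) : ℝ)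

/-- `m` is the length of the minimal period of the continued fraction expansion of `a`
(periodicity from index 1 onward). -/
def IsMinPeriod (a : ℝ) (m : ℕ) : Prop :=
  0 < m ∧ (∀ k, 1 ≤ k → cfA a (k + m) = cfA a k) ∧
    ∀ m', 0 < m' → (∀ k, 1 ≤ k → cfA a (k + m') = cfA a k) → m ≤ m'

/-- The Ostrowski digit conditions for a digit sequence `b`, where `b k` is the coefficient
of `qₖ` (i.e. `b k` is the digit `b_{k+1}` in the classical notation): `b₁ < a₁`,
`bₖ ≤ aₖ` for all `k`, and `b_{k-1} = 0` whenever `bₖ = aₖ`. -/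
def OstrowskiDigits (a : ℝ) (b : ℕ → ℕ) : Prop :=
  (b 0 : ℤ) < cfA a 1 ∧ (∀ k : ℕ, (b k : ℤ) ≤ cfA a (k + 1)) ∧
    ∀ k : ℕ, (b (k + 1) : ℤ) = cfA a (k + 2) → b k = 0

/-- `b` is the (digit sequence of the) Ostrowski representation of `n` based on `a`:
it has finite support, satisfies the digit conditions, and `n = Σ_k b_{k+1}·qₖ`. -/
def IsOstrowskiRep (a : ℝ) (b : ℕ → ℕ) (n : ℕ) : Prop :=
  (∃ K : ℕ, ∀ k : ℕ, K ≤ k → b k = 0) ∧ OstrowskiDigits a b ∧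
    (n : ℝ) = ∑' k : ℕ, (b k : ℝ) * (cfQ a (k + 1) : ℝ)

open FirstOrder

/-- The language of `R_√d`: a binary function `+`, a binary relation `<`,
and two unary predicates (for `ℤ` and for `ℤ√d`). -/
def rLang : FirstOrder.Language where
  Functions := fun n => match n with
    | 2 => Unit
    | _ => Empty
  Relations := fun n => match n with
    | 1 => Bool
    | 2 => Unit
    | _ => Empty

/-- The structure `R_√d = (ℝ; <, +, ℤ, ℤ√d)`. -/
def rStruc (d : ℚ) : rLang.Structure ℝ where
  funMap {n} f v :=
    match n, f, v with
    | 2, _, v => v 0 + v 1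
  RelMap {n} r v :=
    match n, r, v with
    | 1, false, v => ∃ z : ℤ, v 0 = (z : ℝ)
    | 1, true, v => ∃ z : ℤ, v 0 = (z : ℝ) * Real.sqrt d
    | 2, _, v => v 0 < v 1

/-- `(r, p)` and `(r', p')` are consecutive best approximations of `θ` of the second kind. -/
def IsNextApprox (θ : ℝ) (r p r' p' : ℤ) : Prop :=
  0 < r ∧ r < r' ∧ |r' * θ - p'| < |r * θ - p| ∧
    ∀ s : ℤ, 0 < s → s < r' → ∀ q : ℤ, |r * θ - p| ≤ |s * θ - q|

/-- `s` is the least natural number with `sθ` within `ε` of `nθ` modulo `1`. -/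
def IsLeastNear (θ : ℝ) (n : ℤ) (ε : ℝ) (s : ℤ) : Prop :=
  0 ≤ s ∧ (∃ m : ℤ, |(n - s : ℤ) * θ - m| < ε) ∧
    ∀ t : ℤ, 0 ≤ t → t < s → ∀ m : ℤ, ε ≤ |(n - t : ℤ) * θ - m|

lemma Irrational.int_mul_sub_int_ne_zero {θ : ℝ} (hθ : Irrational θ) {r : ℤ} (hr : r ≠ 0)
    (p : ℤ) : r * θ - p ≠ 0 :=
  ((hθ.intCast_mul hr).sub_intCast p).ne_zero

lemma Irrational.int_eq_of_mul_sub_eq {θ : ℝ} (hθ : Irrational θ) {r p s q : ℤ}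
    (h : r * θ - p = s * θ - q) : r = s ∧ p = q := by
  have hrs : r = s := by
    by_contra hne
    refine hθ.int_mul_sub_int_ne_zero (sub_ne_zero.2 hne) (p - q) ?_
    push_cast
    linarith
  subst hrs
  exact ⟨rfl, by exact_mod_cast (sub_right_inj.1 h)⟩

lemma Int.eq_of_abs_sub_lt_half {x : ℝ} {p q : ℤ} (hp : |x - p| < 1 / 2) (hq : |x - q| < 1 / 2) :
    p = q := by
  rw [abs_lt] at hp hq
  have h : |((p - q : ℤ) : ℝ)| < 1 := by
    push_cast
    rw [abs_lt]
    constructor <;> linarith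
  have h' : |p - q| < 1 := by exact_mod_cast h
  rw [Int.abs_lt_one_iff] at h'
  linarith

namespace IsNextApprox

variable {θ : ℝ} {r p r' p' r'' p'' : ℤ}

lemma abs_pos (h : IsNextApprox θ r p r' p') : 0 < |r * θ - p| :=
  (abs_nonneg _).trans_lt h.2.2.1

lemma abs_le_two_sub (h : IsNextApprox θ r p r' p') (h2 : θ < 2) : |r * θ - p| ≤ 2 - θ := by
  have := h.2.2.2 1 one_pos (lt_of_le_of_lt h.1 h.2.1) 2
  rw [abs_sub_comm ((1 : ℤ) * θ)] at this
  push_cast at this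
  rwa [one_mul, abs_of_pos (sub_pos.2 h2)] at this

lemma unique (h : IsNextApprox θ r p r' p') (h' : IsNextApprox θ r p r'' p'') (h1 : 1.5 < θ)
    (h2 : θ < 2) : r' = r'' ∧ p' = p'' := by
  have hr : r' = r'' := by
    rcases lt_trichotomy r' r'' with hlt | heq | hlt
    · exact absurd (h'.2.2.2 r' (h.1.trans h.2.1) hlt p') (not_le.2 h.2.2.1)
    · exact heq
    · exact absurd (h.2.2.2 r'' (h'.1.trans h'.2.1) hlt p'') (not_le.2 h'.2.2.1)
  subst hr
  refine ⟨rfl, ?_⟩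
  have hε := h.abs_le_two_sub h2
  exact Int.eq_of_abs_sub_lt_half (h.2.2.1.trans_le (by linarith))
    (h'.2.2.1.trans_le (by linarith))

lemma mul_abs_le_one (h : IsNextApprox θ r p r' p') : r' * |r * θ - p| ≤ 1 := by
  obtain ⟨n, hn⟩ : ∃ n : ℕ, r' = n + 1 := ⟨(r' - 1).toNat, by have := h.1; have := h.2.1; omega⟩
  have hn0 : 0 < n := by have := h.1; have := h.2.1; omega
  obtain ⟨j, k, hk, hkn, hjk⟩ := Real.exists_int_int_abs_mul_sub_le θ hn0
  have h3 := (h.2.2.2 k hk (by omega) j).trans hjk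
  rw [le_div_iff₀ (by positivity)] at h3
  rw [hn]
  push_cast
  linarith

lemma mul_neg (h : IsNextApprox θ r p r' p')
    (h' : IsNextApprox θ r' p' r'' p'') : (r * θ - p) * (r' * θ - p') < 0 := by
  by_contra! hc
  have h3 := h.2.2.2 (r' - r) (by have := h.2.1; omega) (by have := h.1; omega) (p' - p)
  have h4 := h.2.2.1
  have h5 := h'.abs_pos
  have h6 : |((r' - r : ℤ) : ℝ) * θ - ((p' - p : ℤ) : ℝ)| = |(r' * θ - p') - (r * θ - p)| := by
    push_cast
    congr 1
    ring
  rw [h6] at h3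
  generalize (r : ℝ) * θ - p = x at *
  generalize (r' : ℝ) * θ - p' = y at *
  rcases abs_cases x with hx | hx <;> rcases abs_cases y with hy | hy <;>
    rcases abs_cases (y - x) with hz | hz <;> nlinarith

lemma exists_next (hθ : Irrational θ) (hr : 0 < r)
    (h : ∀ s : ℤ, 0 < s → s ≤ r → ∀ q : ℤ, |r * θ - p| ≤ |s * θ - q|) :
    ∃ r' p', IsNextApprox θ r p r' p' := by
  have hpos : 0 < |r * θ - p| := _root_.abs_pos.2 (hθ.int_mul_sub_int_ne_zero hr.ne' p)
  obtain ⟨n, hn⟩ := exists_nat_one_div_lt hpos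
  have hex : ∃ k : ℕ, 0 < k ∧ ∃ q : ℤ, |(k : ℤ) * θ - q| < |r * θ - p| := by
    obtain ⟨j, k, hk, -, hjk⟩ := Real.exists_int_int_abs_mul_sub_le θ n.succ_pos
    refine ⟨k.toNat, by omega, j, ?_⟩
    rw [Int.toNat_of_nonneg hk.le]
    refine hjk.trans_lt (lt_of_le_of_lt ?_ hn)
    push_cast
    gcongr
    linarith
  classical
  obtain ⟨hk, q, hq⟩ := Nat.find_spec hex
  refine ⟨Nat.find hex, q, hr, ?_, hq, fun s hs hsk t => ?_⟩
  · by_contra! hc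
    exact absurd (h _ (by exact_mod_cast hk) hc q) (not_le.2 hq)
  · by_contra! hc
    refine Nat.find_min hex (m := s.toNat) (by omega) ⟨by omega, t, ?_⟩
    rwa [Int.toNat_of_nonneg hs.le]

lemma exists_next' (hθ : Irrational θ) (h1 : 1.5 < θ) (h2 : θ < 2) (h : IsNextApprox θ r p r' p') :
    ∃ r'' p'', IsNextApprox θ r' p' r'' p'' := by
  refine exists_next hθ (h.1.trans h.2.1) fun s hs hsr q => ?_
  rcases hsr.lt_or_eq with hlt | rfl
  · exact h.2.2.1.le.trans (h.2.2.2 s hs hlt q)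
  · by_contra! hc
    have hlt := hc.trans h.2.2.1
    have hε := h.abs_le_two_sub h2
    have hq : |s * θ - q| < 1 / 2 := hlt.trans_le (by linarith)
    obtain rfl := Int.eq_of_abs_sub_lt_half hq (h.2.2.1.trans_le (by linarith))
    exact hc.false

end IsNextApprox

namespace IsLeastNear

variable {θ ε ε' : ℝ} {n s t : ℤ}

lemma exists_of_pos (hn : 0 ≤ n) (hε : 0 < ε) : ∃ s, IsLeastNear θ n ε s := by
  classical
  have hex : ∃ k : ℕ, ∃ m : ℤ, |(n - k : ℤ) * θ - m| < ε := by
    refine ⟨n.toNat, 0, ?_⟩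
    rw [Int.toNat_of_nonneg hn]
    simpa using hε
  refine ⟨Nat.find hex, by omega, Nat.find_spec hex, fun t ht hts m => ?_⟩
  by_contra! hc
  refine Nat.find_min hex (m := t.toNat) (by omega) ⟨m, ?_⟩
  rwa [Int.toNat_of_nonneg ht]

lemma unique (hs : IsLeastNear θ n ε s) (ht : IsLeastNear θ n ε t) : s = t := by
  obtain ⟨hs0, ⟨m, hm⟩, hs⟩ := hs
  obtain ⟨ht0, ⟨k, hk⟩, ht⟩ := ht
  rcases lt_trichotomy s t with hlt | heq | hlt
  · exact absurd (ht s hs0 hlt m) (not_le.2 hm)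
  · exact heq
  · exact absurd (hs t ht0 hlt k) (not_le.2 hk)

lemma mono (hs : IsLeastNear θ n ε s) (ht : IsLeastNear θ n ε' t) (h : ε' ≤ ε) : s ≤ t := by
  by_contra! hc
  obtain ⟨m, hm⟩ := ht.2.1
  exact absurd (hs.2.2 t ht.1 hc m) (not_le.2 (hm.trans_le h))

lemma le_self (hn : 0 ≤ n) (hε : 0 < ε) (hs : IsLeastNear θ n ε s) : s ≤ n := by
  by_contra! hc
  have := hs.2.2 n hn hc 0
  simp at this
  linarith

/-- Subtracting from `s` denominators of approximations of either sign keeps `sθ` near `nθ`. -/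
lemma lt_of_mul_neg (hs : IsLeastNear θ n ε s) {r p r' p' : ℤ} (hr : 0 < r) (hr' : 0 < r')
    (h : |r * θ - p| < ε) (h' : |r' * θ - p'| < ε) (hneg : (r * θ - p) * (r' * θ - p') < 0) :
    s < max r r' := by
  by_contra! hc
  obtain ⟨hs0, ⟨m, hm⟩, hs⟩ := hs
  have h3 := hs (s - r) (by have := le_max_left r r'; omega) (by omega) (m + p)
  have h4 := hs (s - r') (by have := le_max_right r r'; omega) (by omega) (m + p')
  have e (r p : ℤ) : ((n - (s - r) : ℤ) : ℝ) * θ - (m + p : ℤ) =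
      ((n - s : ℤ) * θ - m) + (r * θ - p) := by
    push_cast
    ring
  rw [e] at h3 h4
  generalize ((n - s : ℤ) : ℝ) * θ - m = z at *
  generalize (r : ℝ) * θ - p = x at *
  generalize (r' : ℝ) * θ - p' = y at *
  rw [abs_lt] at h h' hm
  rw [le_abs] at h3 h4
  rcases h3 with h3 | h3 <;> rcases h4 with h4 | h4 <;> nlinarith

end IsLeastNear

/-- `θ` is badly approximable with constant `1 / C`. -/
def IsBadlyApprox (θ : ℝ) (C : ℤ) : Prop :=
  ∀ r p : ℤ, 0 < r → |r * θ - p| < 1 → 1 ≤ C * (r * |r * θ - p|)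

section

variable {θ : ℝ} {C r p r' p' r'' p'' n s t s' t' : ℤ}

lemma IsNextApprox.le_mul (h : IsNextApprox θ r p r' p') (h1 : 1.5 < θ) (h2 : θ < 2)
    (hC : IsBadlyApprox θ C) : r' ≤ C * r := by
  have hz := h.abs_pos
  have h3 := hC r p h.1 ((h.abs_le_two_sub h2).trans_lt (by linarith))
  have h4 := h.mul_abs_le_one
  have h5 : (r' : ℝ) ≤ C * r := by
    by_contra! hc
    nlinarith
  exact_mod_cast h5

lemma IsLeastNear.le_mul (hθ : Irrational θ) (h1 : 1.5 < θ) (h2 : θ < 2)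
    (hC : IsBadlyApprox θ C) (h : IsNextApprox θ r p r' p')
    (hs : IsLeastNear θ n |r * θ - p| s) : s ≤ C * r' := by
  obtain ⟨r'', p'', h'⟩ := h.exists_next' hθ h1 h2
  obtain ⟨r₃, p₃, h''⟩ := h'.exists_next' hθ h1 h2
  have h3 := hs.lt_of_mul_neg h'.1 h''.1 h.2.2.1 (h'.2.2.1.trans h.2.2.1) (h'.mul_neg h'')
  have h4 := h'.le_mul h1 h2 hC
  rw [max_eq_right h'.2.1.le] at h3
  linarith

lemma IsNextApprox.exists_lattice_coords (hθ : Irrational θ) (h1 : 1.5 < θ) (h2 : θ < 2)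
    (hC : IsBadlyApprox θ C) (hC0 : 0 ≤ C) (h : IsNextApprox θ r p r' p')
    (hs : IsLeastNear θ n |r * θ - p| s) (hs' : IsLeastNear θ n |r' * θ - p'| s') :
    ∃ D ∈ Finset.Icc (-(C ^ 2 + 2)) (C ^ 2 + 2), ∃ a ∈ Finset.Icc (-(C ^ 2 + 2)) (C ^ 2 + 2),
      ∃ b ∈ Finset.Icc (-(C ^ 2 + 2)) (C ^ 2 + 2), D ≠ 0 ∧ D * (s' - s) = a * r + b * r' := by
  obtain ⟨r'', p'', h'⟩ := h.exists_next' hθ h1 h2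
  have hj := hs.mono hs' h.2.2.1.le
  have hs0 := hs.1
  have hs'C := hs'.le_mul hθ h1 h2 hC h'
  have hr'' := h'.le_mul h1 h2 hC
  have hneg := h.mul_neg h'
  obtain ⟨m, hm⟩ := hs.2.1
  obtain ⟨m', hm'⟩ := hs'.2.1
  have hr := h.1
  have hrr := h.2.1
  have hzz := h.2.2.1
  have hz' := h'.abs_pos
  have hrz := h.mul_abs_le_one
  have hrz' := h'.mul_abs_le_one
  have hζ : ((s' - s : ℤ) : ℝ) * θ - (m - m' : ℤ) =
      ((n - s : ℤ) * θ - m) - ((n - s' : ℤ) * θ - m') := by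
    push_cast
    ring
  have hζ2 : |((s' - s : ℤ) : ℝ) * θ - (m - m' : ℤ)| ≤ 2 * |r * θ - p| := by
    rw [hζ]
    refine (abs_sub _ _).trans ?_
    linarith
  set j := s' - s with hjdef
  set k := m - m'
  have hjC : j ≤ C * (C * r') := by
    have : C * r'' ≤ C * (C * r') := mul_le_mul_of_nonneg_left hr'' hC0
    linarith
  have hj0 : 0 ≤ j := by linarith
  have hjC' : j ≤ C * r'' := by linarith
  have hjz' : j * |r' * θ - p'| ≤ C := by
    have e1 : (j : ℝ) ≤ C * r'' := by exact_mod_cast hjC'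
    have e2 : (0 : ℝ) ≤ C := by exact_mod_cast hC0
    nlinarith
  have hjz : j * |r * θ - p| ≤ C ^ 2 := by
    have e1 : (j : ℝ) ≤ C * (C * r') := by exact_mod_cast hjC
    have e2 : (0 : ℝ) ≤ (C : ℝ) ^ 2 := by positivity
    nlinarith [h.abs_pos]
  have hCC : (C : ℝ) ≤ C ^ 2 := by exact_mod_cast Int.le_self_sq C
  have hr0 : (0 : ℝ) < r := by exact_mod_cast hr
  have hrr0 : (r : ℝ) < r' := by exact_mod_cast hrr
  have hj0' : (0 : ℝ) ≤ j := by exact_mod_cast hj0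
  have hzpos := h.abs_pos
  have key (x : ℤ) (u v : ℝ) (hx : (x : ℝ) = u - v) (huv : |u| + |v| ≤ C ^ 2 + 2) :
      x ∈ Finset.Icc (-(C ^ 2 + 2)) (C ^ 2 + 2) := by
    rw [Finset.mem_Icc, ← abs_le]
    have : |(x : ℝ)| ≤ C ^ 2 + 2 := by
      rw [hx]
      exact (abs_sub _ _).trans huv
    exact_mod_cast this
  refine ⟨r * p' - p * r', ?_, j * p' - k * r', ?_, r * k - p * j, ?_, ?_, by ring⟩
  · refine key _ (r' * (r * θ - p)) (r * (r' * θ - p')) (by push_cast; ring) ?_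
    rw [abs_mul, abs_mul, abs_of_pos hr0, abs_of_pos (hr0.trans hrr0)]
    have : (0 : ℝ) ≤ C ^ 2 := by positivity
    nlinarith
  · refine key _ (r' * (j * θ - k)) (j * (r' * θ - p')) (by push_cast; ring) ?_
    rw [abs_mul, abs_mul, abs_of_nonneg hj0', abs_of_pos (hr0.trans hrr0)]
    nlinarith
  · refine key _ (j * (r * θ - p)) (r * (j * θ - k)) (by push_cast; ring) ?_
    rw [abs_mul, abs_mul, abs_of_nonneg hj0', abs_of_pos hr0]
    nlinarith
  · intro hD
    have hD' : (r : ℝ) * p' - p * r' = 0 := by exact_mod_cast hD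
    have e : r' * ((r : ℝ) * θ - p) = r * (r' * θ - p') := by linear_combination hD'
    have : r' * ((r : ℝ) * θ - p) ^ 2 = r * ((r * θ - p) * (r' * θ - p')) := by
      linear_combination (r * θ - p) * e
    have e3 : 0 ≤ r' * ((r : ℝ) * θ - p) ^ 2 := by
      have := hr0.trans hrr0
      positivity
    nlinarith

lemma isNextApprox_one (hθ : Irrational θ) (h1 : 1.5 < θ) (h2 : θ < 2) :
    ∃ r' p', IsNextApprox θ 1 2 r' p' := by
  refine IsNextApprox.exists_next hθ one_pos fun s hs hs1 q => ?_
  obtain rfl : s = 1 := by omega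
  by_contra! hc
  push_cast at hc
  have h3 : |1 * θ - 2| < 1 / 2 := by rw [abs_lt]; constructor <;> linarith
  have := Int.eq_of_abs_sub_lt_half (p := q) (q := 2) (hc.trans h3) (by exact_mod_cast h3)
  subst this
  exact hc.false

/-- The step condition saying that `s, t` and `s', t'` differ by the same lattice vector. -/
def SameStep (N r r' j R R' J : ℤ) : Prop :=
  ∃ D ∈ Finset.Icc (-N) N, ∃ a ∈ Finset.Icc (-N) N, ∃ b ∈ Finset.Icc (-N) N,
    D ≠ 0 ∧ D * j = a * r + b * r' ∧ D * J = a * R + b * R'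

theorem eq_iff_forall_sameStep (hθ : Irrational θ) (h1 : 1.5 < θ) (h2 : θ < 2)
    (hC : IsBadlyApprox θ C) (hC0 : 0 ≤ C) : ∃ N : ℤ, ∀ n n' : ℤ, 0 ≤ n → 0 ≤ n' →
      (n = n' ↔ ∀ r p r' p' s s' t t' : ℤ, IsNextApprox θ r p r' p' →
        IsLeastNear θ n |r * θ - p| s → IsLeastNear θ n |r' * θ - p'| s' →
        IsLeastNear θ n' |r * θ - p| t → IsLeastNear θ n' |r' * θ - p'| t' →
        SameStep N r r' (s' - s) r r' (t' - t) ∧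
          (r = 1 → ∃ i ∈ Finset.Icc (-N) N, s = i * r ∧ t = i * r)) := by
  obtain ⟨r₁, p₁, h₁⟩ := isNextApprox_one hθ h1 h2
  refine ⟨max (C ^ 2 + 2) (C * r₁), fun n n' hn hn' => ⟨?_, fun H => ?_⟩⟩
  · rintro rfl r p r' p' s s' t t' h hs hs' ht ht'
    obtain rfl := hs.unique ht
    obtain rfl := hs'.unique ht'
    constructor
    · obtain ⟨D, hD, a, ha, b, hb, hD0, e⟩ := h.exists_lattice_coords hθ h1 h2 hC hC0 hs hs'
      have hsub : Finset.Icc (-(C ^ 2 + 2)) (C ^ 2 + 2) ⊆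
          Finset.Icc (-max (C ^ 2 + 2) (C * r₁)) (max (C ^ 2 + 2) (C * r₁)) :=
        Finset.Icc_subset_Icc (by simp) (by simp)
      exact ⟨D, hsub hD, a, hsub ha, b, hsub hb, hD0, e, e⟩
    · rintro rfl
      have hp : p = 2 := by
        have hε := h.abs_le_two_sub h2
        have hp : |(1 : ℤ) * θ - p| < 1 / 2 := hε.trans_lt (by linarith)
        refine Int.eq_of_abs_sub_lt_half hp ?_
        push_cast
        rw [abs_lt]
        constructor <;> linarith
      subst hp
      obtain ⟨rfl, rfl⟩ := h.unique h₁ h1 h2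
      have := hs.le_mul hθ h1 h2 hC h
      refine ⟨s, Finset.mem_Icc.2 ⟨?_, this.trans (le_max_right _ _)⟩, by simp, by simp⟩
      have h3 := hs.1
      have h4 : 0 ≤ max (C ^ 2 + 2) (C * r') := le_max_of_le_left (by positivity)
      omega
  · have chain (k : ℕ) : ∃ r p r' p' : ℤ, k < r ∧ IsNextApprox θ r p r' p' ∧
        ∃ s, IsLeastNear θ n |r * θ - p| s ∧ IsLeastNear θ n' |r * θ - p| s := by
      induction k with
      | zero =>
        obtain ⟨s, hs⟩ := IsLeastNear.exists_of_pos (θ := θ) hn h₁.abs_pos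
        obtain ⟨t, ht⟩ := IsLeastNear.exists_of_pos (θ := θ) hn' h₁.abs_pos
        obtain ⟨r₂, p₂, h₂⟩ := h₁.exists_next' hθ h1 h2
        obtain ⟨s', hs'⟩ := IsLeastNear.exists_of_pos (θ := θ) hn h₂.abs_pos
        obtain ⟨t', ht'⟩ := IsLeastNear.exists_of_pos (θ := θ) hn' h₂.abs_pos
        obtain ⟨i, -, rfl, rfl⟩ := (H _ _ _ _ _ _ _ _ h₁ hs hs' ht ht').2 rfl
        exact ⟨1, 2, r₁, p₁, by simp, h₁, _, hs, ht⟩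
      | succ k ih =>
        obtain ⟨r, p, r', p', hk, h, s, hs, ht⟩ := ih
        obtain ⟨r'', p'', h'⟩ := h.exists_next' hθ h1 h2
        obtain ⟨s', hs'⟩ := IsLeastNear.exists_of_pos (θ := θ) hn h'.abs_pos
        obtain ⟨t', ht'⟩ := IsLeastNear.exists_of_pos (θ := θ) hn' h'.abs_pos
        obtain ⟨D, -, a, -, b, -, hD0, e, e'⟩ := (H _ _ _ _ _ _ _ _ h hs hs' ht ht').1
        have : s' = t' := by
          have := mul_left_cancel₀ hD0 (e.trans e'.symm)
          omega
        subst this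
        exact ⟨r', p', r'', p'', by have := h.2.1; push_cast; omega, h', s', hs', ht'⟩
    obtain ⟨r, p, r', p', hk, h, s, hs, ht⟩ := chain (n.toNat + n'.toNat)
    have key (n : ℤ) (hn : 0 ≤ n) (hnr : n < r) (hs : IsLeastNear θ n |r * θ - p| s) : s = n := by
      refine (hs.le_self hn h.abs_pos).antisymm ?_
      by_contra! hc
      obtain ⟨m, hm⟩ := hs.2.1
      exact absurd (h.2.2.2 (n - s) (by omega) (by have := h.2.1; have := hs.1; omega) m)
        (not_le.2 hm)
    rw [← key n hn (by omega) hs, ← key n' hn' (by omega) ht]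

lemma IsNextApprox.two_mul_le_of_lt {r₁ p₁ : ℤ} (h : IsNextApprox θ r p r' p')
    (h' : IsNextApprox θ r'' p'' r₁ p₁) (hpos : 0 < (r * θ - p) * (r'' * θ - p''))
    (hlt : |r * θ - p| < |r'' * θ - p''|) : 2 * |r * θ - p| ≤ |r'' * θ - p''| := by
  have hr : r'' < r := by
    by_contra! hc
    exact absurd (h'.2.2.2 r h.1 (hc.trans_lt h'.2.1) p) (not_le.2 hlt)
  have h3 := h.2.2.2 (r - r'') (by omega) (by have := h.2.1; have := h'.1; omega) (p - p'')
  have e : ((r - r'' : ℤ) : ℝ) * θ - (p - p'' : ℤ) = (r * θ - p) - (r'' * θ - p'') := by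
    push_cast
    ring
  rw [e] at h3
  generalize (r : ℝ) * θ - p = x at *
  generalize (r'' : ℝ) * θ - p'' = y at *
  rcases abs_cases x with hx | hx <;> rcases abs_cases y with hy | hy <;>
    rcases abs_cases (x - y) with hz | hz <;> nlinarith

/-- Being between `x` and `2 * x`. -/
def IsScaledMatch (x y : ℝ) : Prop :=
  (x < y ∧ y < x + x) ∨ (y < x ∧ x + x < y)

lemma IsNextApprox.isScaledMatch_iff (hθ : Irrational θ) {r₁ p₁ : ℤ} (h1 : 1.5 < θ) (h2 : θ < 2)
    (h : IsNextApprox θ r p r' p') (h' : IsNextApprox θ r'' p'' r₁ p₁) :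
    IsScaledMatch (r * θ - p) (θ * (r'' * θ - p'')) ↔ r'' = r ∧ p'' = p := by
  have hx := h.abs_pos
  have hy := h'.abs_pos
  constructor
  · intro hm
    refine hθ.int_eq_of_mul_sub_eq ?_
    have ha := h.two_mul_le_of_lt h'
    have hb := h'.two_mul_le_of_lt h
    rw [mul_comm (_ - _)] at hb
    generalize (r : ℝ) * θ - p = x at *
    generalize (r'' : ℝ) * θ - p'' = y at *
    have hxy : 0 < x * y := by
      rcases hm with hm | hm
      · have : 0 < x := by linarith
        have : 0 < y := pos_of_mul_pos_right (this.trans hm.1) (by linarith)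
        positivity
      · have : x < 0 := by linarith
        have : y < 0 := by nlinarith
        nlinarith
    have hxy' : |y| = |x| := by
      rcases lt_trichotomy |x| |y| with hlt | heq | hlt
      · have := ha hxy hlt
        rcases hm with hm | hm <;> rcases abs_cases x with hx | hx <;>
          rcases abs_cases y with hy | hy <;> nlinarith
      · exact heq.symm
      · have := hb hxy hlt
        rcases hm with hm | hm <;> rcases abs_cases x with hx | hx <;>
          rcases abs_cases y with hy | hy <;> nlinarith
    rcases abs_eq_abs.1 hxy' with h | h
    · exact h
    · subst h
      nlinarith
  · rintro ⟨rfl, rfl⟩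
    rcases lt_or_gt_of_ne (_root_.abs_pos.1 hx) with h | h
    · right
      constructor <;> nlinarith
    · left
      constructor <;> nlinarith

end

section Ostrowski

variable {a : ℝ}

lemma irrational_cfZeta (ha : Irrational a) (k : ℕ) : Irrational (cfZeta a k) := by
  induction k with
  | zero => exact ha
  | succ k ih => exact (ih.sub_intCast _).inv

lemma fract_cfZeta_pos (ha : Irrational a) (k : ℕ) : 0 < Int.fract (cfZeta a k) :=
  (Int.fract_nonneg _).lt_of_ne' ((irrational_cfZeta ha k).sub_intCast _).ne_zero

lemma one_lt_cfZeta_succ (ha : Irrational a) (k : ℕ) : 1 < cfZeta a (k + 1) :=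
  (one_lt_inv₀ (fract_cfZeta_pos ha k)).2 (Int.fract_lt_one _)

lemma one_le_cfA_succ (ha : Irrational a) (k : ℕ) : 1 ≤ cfA a (k + 1) :=
  Int.le_floor.2 (by exact_mod_cast (one_lt_cfZeta_succ ha k).le)

lemma cfQ_succ_pos_and_nonneg (ha : Irrational a) (k : ℕ) : 0 < cfQ a (k + 1) ∧ 0 ≤ cfQ a k := by
  induction k with
  | zero => simp [cfQ]
  | succ k ih =>
    refine ⟨?_, ih.1.le⟩
    have := one_le_cfA_succ ha k
    rw [cfQ]
    nlinarith [ih.1, ih.2]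

lemma le_cfQ_succ (ha : Irrational a) (k : ℕ) : (k : ℤ) ≤ cfQ a (k + 1) := by
  induction k with
  | zero => simp [cfQ]
  | succ k ih =>
    have h1 := one_le_cfA_succ ha k
    rcases k with _ | k
    · simpa [cfQ] using h1
    · have h2 := (cfQ_succ_pos_and_nonneg ha k).1
      have h3 := (cfQ_succ_pos_and_nonneg ha (k + 1)).1
      rw [cfQ]
      push_cast at ih ⊢
      nlinarith

/-- Every `n < qₖ` has an Ostrowski representation with digits below index `k`. -/
lemma exists_ostrowskiDigits_of_lt (ha : Irrational a) (K : ℕ) :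
    (∀ n : ℤ, 0 ≤ n → n < cfQ a (K + 1) → ∃ b : ℕ → ℕ, (∀ k, K ≤ k → b k = 0) ∧
      OstrowskiDigits a b ∧ n = ∑ k ∈ Finset.range K, b k * cfQ a (k + 1)) ∧
    ∀ n : ℤ, 0 ≤ n → n < cfQ a (K + 2) → ∃ b : ℕ → ℕ, (∀ k, K + 1 ≤ k → b k = 0) ∧
      OstrowskiDigits a b ∧ n = ∑ k ∈ Finset.range (K + 1), b k * cfQ a (k + 1) := by
  induction K with
  | zero =>
    refine ⟨fun n hn hn' => ⟨0, by simp, ⟨?_, ?_, by simp⟩, ?_⟩, fun n hn hn' =>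
      ⟨Function.update 0 0 n.toNat, fun k hk => ?_, ⟨?_, fun k => ?_, fun k hk => ?_⟩, ?_⟩⟩
    · simpa using zero_lt_one.trans_le (one_le_cfA_succ ha 0)
    · intro k
      simpa using (zero_le_one.trans (one_le_cfA_succ ha k))
    · simp [cfQ] at hn' ⊢
      omega
    · simp [show k ≠ 0 by omega]
    · simp [cfQ] at hn' ⊢
      omega
    · rcases k with _ | k
      · simp [cfQ] at hn' ⊢
        omega
      · simpa using (zero_le_one.trans (one_le_cfA_succ ha (k + 1)))
    · have := one_le_cfA_succ ha (k + 1)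
      simp at hk
      rw [← hk] at this
      omega
    · simp [cfQ, hn]
  | succ K ih =>
    refine ⟨ih.2, fun n hn hn' => ?_⟩
    have hq := (cfQ_succ_pos_and_nonneg ha (K + 1)).1
    have hdm := Int.emod_add_mul_ediv n (cfQ a (K + 2))
    have hm0 := Int.emod_nonneg n hq.ne'
    have hmlt := Int.emod_lt_of_pos n hq
    have hc0 := Int.ediv_nonneg hn hq.le
    have extend (b : ℕ → ℕ) (hb : ∀ k, K + 1 ≤ k → b k = 0) (hd : OstrowskiDigits a b)
        (hs : n % cfQ a (K + 2) = ∑ k ∈ Finset.range (K + 1), b k * cfQ a (k + 1))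
        (hle : n / cfQ a (K + 2) ≤ cfA a (K + 2))
        (hz : n / cfQ a (K + 2) = cfA a (K + 2) → b K = 0) :
        ∃ b : ℕ → ℕ, (∀ k, K + 1 + 1 ≤ k → b k = 0) ∧
          OstrowskiDigits a b ∧ n = ∑ k ∈ Finset.range (K + 1 + 1), b k * cfQ a (k + 1) := by
      refine ⟨Function.update b (K + 1) (n / cfQ a (K + 2)).toNat, fun k hk => ?_,
        ⟨?_, fun k => ?_, fun k hk => ?_⟩, ?_⟩
      · rw [Function.update_of_ne (by omega)]
        exact hb k (by omega)
      · rw [Function.update_of_ne (by omega)]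
        exact hd.1
      · rcases eq_or_ne k (K + 1) with rfl | hne
        · simpa [Int.toNat_of_nonneg hc0] using hle
        · rw [Function.update_of_ne hne]
          exact hd.2.1 k
      · rcases eq_or_ne k K with rfl | hne
        · rw [Function.update_of_ne (by omega)]
          apply hz
          rwa [Function.update_self, Int.toNat_of_nonneg hc0] at hk
        · rw [Function.update_of_ne (by omega)] at hk
          rcases eq_or_ne k (K + 1) with rfl | hne'
          · rw [hb _ (by omega)] at hk
            have := one_le_cfA_succ ha (K + 1 + 1)
            rw [← hk] at this
            simp at this
          · rw [Function.update_of_ne hne']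
            exact hd.2.2 k hk
      · rw [Finset.sum_range_succ, Function.update_self, Int.toNat_of_nonneg hc0]
        rw [Finset.sum_congr rfl fun k hk => by
          rw [Function.update_of_ne (Finset.mem_range.1 hk).ne], ← hs]
        linarith
    rw [cfQ] at hn'
    have hqK := (cfQ_succ_pos_and_nonneg ha K).1
    rcases lt_or_ge (n / cfQ a (K + 2)) (cfA a (K + 2)) with hlt | hge
    · obtain ⟨b, hb, hd, hs⟩ := ih.2 _ hm0 hmlt
      exact extend b hb hd hs hlt.le fun h => absurd h hlt.ne
    · have hle : n / cfQ a (K + 2) ≤ cfA a (K + 2) := by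
        have hmono : cfQ a (K + 1) ≤ cfQ a (K + 2) := by
          have h1 := one_le_cfA_succ ha K
          have h2 := (cfQ_succ_pos_and_nonneg ha K).2
          rw [cfQ]
          nlinarith
        by_contra! hc
        nlinarith
      have heq := hle.antisymm hge
      rw [heq] at hdm
      obtain ⟨b, hb, hd, hs⟩ := ih.1 (n % cfQ a (K + 2)) hm0 (by linarith)
      refine extend b (fun k hk => hb k (by omega)) hd ?_ hle fun _ => hb K le_rfl
      rw [Finset.sum_range_succ, hb K le_rfl, hs]
      simp

lemma IsOstrowskiRep.cast_eq_sum {b : ℕ → ℕ} {n K : ℕ} (h : IsOstrowskiRep a b n)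
    (hK : ∀ k, K ≤ k → b k = 0) : (n : ℤ) = ∑ k ∈ Finset.range K, b k * cfQ a (k + 1) := by
  have := h.2.2
  rw [tsum_eq_sum (s := Finset.range K)
    (fun k hk => by rw [hK k (by simpa using hk), Nat.cast_zero, zero_mul])] at this
  exact_mod_cast this

lemma exists_isOstrowskiRep (ha : Irrational a) (n : ℕ) : ∃ b, IsOstrowskiRep a b n := by
  have hlt : (n : ℤ) < cfQ a (n + 1 + 1) := by
    have := le_cfQ_succ ha (n + 1)
    push_cast at this
    omega
  obtain ⟨b, hb, hd, hs⟩ := (exists_ostrowskiDigits_of_lt ha (n + 1)).1 n (by omega) hlt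
  refine ⟨b, ⟨n + 1, hb⟩, hd, ?_⟩
  rw [tsum_eq_sum (s := Finset.range (n + 1))
    (fun k hk => by rw [hb k (by simpa using hk), Nat.cast_zero, zero_mul])]
  exact_mod_cast hs

/-- The absolute value of the `k`-th difference, with indices shifted by one as in `cfQ`. -/
noncomputable def cfGap (a : ℝ) (k : ℕ) : ℝ := (-1) ^ (k + 1) * (cfQ a k * a - cfP a k)

lemma cfGap_zero : cfGap a 0 = 1 := by simp [cfGap, cfQ, cfP]

lemma cfGap_one : cfGap a 1 = a - cfA a 0 := by simp [cfGap, cfQ, cfP]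

lemma cfGap_add_two (k : ℕ) : cfGap a k = cfA a (k + 1) * cfGap a (k + 1) + cfGap a (k + 2) := by
  simp only [cfGap, cfQ, cfP]
  push_cast
  ring

lemma cfGap_succ_mul_cfZeta (ha : Irrational a) (k : ℕ) :
    cfGap a (k + 1) * cfZeta a (k + 1) = cfGap a k := by
  induction k with
  | zero =>
    rw [zero_add, cfGap_one, cfGap_zero]
    exact mul_inv_cancel₀ (fract_cfZeta_pos ha 0).ne'
  | succ k ih =>
    have h := cfGap_add_two (a := a) k
    have hf := (fract_cfZeta_pos ha (k + 1)).ne'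
    rw [Int.fract] at hf
    have e : cfGap a (k + 2) = cfGap a (k + 1) * (cfZeta a (k + 1) - ⌊cfZeta a (k + 1)⌋) := by
      rw [cfA] at h
      linear_combination -h - ih
    rw [e]
    change _ * (cfZeta a (k + 1) - ⌊cfZeta a (k + 1)⌋)⁻¹ = _
    rw [mul_assoc, mul_inv_cancel₀ hf, mul_one]

lemma cfGap_pos (ha : Irrational a) (k : ℕ) : 0 < cfGap a k := by
  induction k with
  | zero => rw [cfGap_zero]; exact one_pos
  | succ k ih =>
    rw [← cfGap_succ_mul_cfZeta ha] at ih
    exact pos_of_mul_pos_left ih (zero_lt_one.trans (one_lt_cfZeta_succ ha k)).le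

lemma cfBeta_eq_cfGap (k : ℕ) : cfBeta a k = (-1) ^ k * cfGap a (k + 1) := by
  rw [cfGap, cfBeta, ← mul_assoc, ← pow_add, Even.neg_one_pow ⟨k + 1, by ring⟩, one_mul]

lemma ostrowski_tail_bounds (ha : Irrational a) {b : ℕ → ℕ}
    (hb : ∀ k : ℕ, (b k : ℤ) ≤ cfA a (k + 1)) (l k : ℕ) :
    -cfGap a (k + 1) < (-1) ^ k * ∑ i ∈ Finset.range l, (b (k + i) : ℝ) * cfBeta a (k + i) ∧
    (-1) ^ k * ∑ i ∈ Finset.range l, (b (k + i) : ℝ) * cfBeta a (k + i) <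
      b k * cfGap a (k + 1) + cfGap a (k + 2) := by
  induction l generalizing k with
  | zero =>
    have h1 := cfGap_pos ha (k + 1)
    have h2 := cfGap_pos ha (k + 2)
    simp only [Finset.range_zero, Finset.sum_empty, mul_zero]
    exact ⟨by linarith, by positivity⟩
  | succ l ih =>
    have h1 := cfGap_pos ha (k + 1)
    have hg := cfGap_add_two (a := a) (k + 1)
    obtain ⟨h3, h4⟩ := ih (k + 1)
    have hb1 : (b (k + 1) : ℝ) ≤ cfA a (k + 2) := by exact_mod_cast hb (k + 1)
    have hb0 : (0 : ℝ) ≤ b k := by positivity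
    have e : (-1) ^ k * ∑ i ∈ Finset.range (l + 1), (b (k + i) : ℝ) * cfBeta a (k + i) =
        b k * cfGap a (k + 1) - (-1) ^ (k + 1) *
          ∑ i ∈ Finset.range l, (b (k + 1 + i) : ℝ) * cfBeta a (k + 1 + i) := by
      have hs : ((-1 : ℝ) ^ k) * (-1) ^ k = 1 := by
        rw [← pow_add]
        exact Even.neg_one_pow ⟨k, rfl⟩
      rw [Finset.sum_range_succ', add_zero, cfBeta_eq_cfGap k]
      rw [Finset.sum_congr rfl (fun i _ => by rw [show k + (i + 1) = k + 1 + i by ring])]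
      linear_combination (b k * cfGap a (k + 1)) * hs
    rw [e]
    have h5 := cfGap_pos ha (k + 2)
    constructor <;> nlinarith

/-- The value of `f` at `n√d` is the representative of `na` modulo `1` between `a₀ - a` and
`a₀ - a + 1`. -/
lemma IsOstrowskiRep.exists_tsum_eq (ha : Irrational a) {b : ℕ → ℕ} {n : ℕ}
    (h : IsOstrowskiRep a b n) : ∃ m : ℤ, ∑' k : ℕ, (b k : ℝ) * cfBeta a k = n * a - m ∧
      cfA a 0 - a < n * a - m ∧ n * a - m < cfA a 0 - a + 1 := by
  obtain ⟨K, hK⟩ := h.1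
  have hn : (n : ℝ) = ∑ k ∈ Finset.range K, (b k : ℝ) * cfQ a (k + 1) := by
    exact_mod_cast h.cast_eq_sum hK
  have hsum : ∑' k : ℕ, (b k : ℝ) * cfBeta a k = ∑ k ∈ Finset.range K, (b k : ℝ) * cfBeta a k :=
    tsum_eq_sum fun k hk => by rw [hK k (by simpa using hk), Nat.cast_zero, zero_mul]
  have hval : ∑ k ∈ Finset.range K, (b k : ℝ) * cfBeta a k =
      n * a - ((∑ k ∈ Finset.range K, b k * cfP a (k + 1) : ℤ) : ℝ) := by
    rw [hn]
    push_cast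
    rw [Finset.sum_mul, ← Finset.sum_sub_distrib]
    refine Finset.sum_congr rfl fun k _ => ?_
    rw [cfBeta]
    ring
  refine ⟨∑ k ∈ Finset.range K, b k * cfP a (k + 1), hsum.trans hval, ?_⟩
  rw [← hval]
  have ht := ostrowski_tail_bounds ha h.2.1.2.1 K 0
  simp only [pow_zero, one_mul, zero_add] at ht
  have hg := cfGap_add_two (a := a) 0
  rw [zero_add, zero_add] at hg
  have hb0 : (b 0 : ℝ) + 1 ≤ cfA a 1 := by exact_mod_cast h.2.1.1
  have h1 := cfGap_pos ha 1
  rw [cfGap_zero] at hg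
  have h01 := cfGap_one (a := a)
  constructor <;> nlinarith

end Ostrowski

section Definability

variable {d : ℚ} {α β : Type}

/-- `P` defines a subset of `α → ℝ` in `R_√d` without parameters. -/
def DefPred (d : ℚ) (P : (α → ℝ) → Prop) : Prop :=
  letI := rStruc d
  Set.Definable ∅ rLang {v : α → ℝ | P v}

namespace DefPred

variable {P Q : (α → ℝ) → Prop}

lemma congr (h : DefPred d P) (hPQ : ∀ v, P v ↔ Q v) : DefPred d Q := by
  rwa [show Q = P from funext fun v => propext (hPQ v).symm]

lemma and (hP : DefPred d P) (hQ : DefPred d Q) : DefPred d fun v => P v ∧ Q v :=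
  letI := rStruc d
  Set.Definable.inter hP hQ

lemma or (hP : DefPred d P) (hQ : DefPred d Q) : DefPred d fun v => P v ∨ Q v :=
  letI := rStruc d
  Set.Definable.union hP hQ

lemma not (hP : DefPred d P) : DefPred d fun v => ¬P v :=
  letI := rStruc d
  Set.Definable.compl hP

lemma imp (hP : DefPred d P) (hQ : DefPred d Q) : DefPred d fun v => P v → Q v :=
  (hP.not.or hQ).congr fun _ => imp_iff_not_or.symm

lemma reindex {P : (β → ℝ) → Prop} (hP : DefPred d P) (σ : β → α) :
    DefPred d fun v : α → ℝ => P fun i => v (σ i) :=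
  letI := rStruc d
  Set.Definable.preimage_comp σ hP

lemma ex {Q : (α → ℝ) → ℝ → Prop}
    (hQ : DefPred d fun w : Option α → ℝ => Q (fun i => w (some i)) (w none)) :
    DefPred d fun v => ∃ y, Q v y := by
  let := rStruc d
  have h := Set.Definable.exists_of_finite (β := Unit)
    (hQ.reindex fun o : Option α => o.elim (Sum.inr ()) Sum.inl)
  refine DefPred.congr (d := d) h fun v =>
    ⟨fun ⟨u, hu⟩ => ⟨u (), hu⟩, fun ⟨y, hy⟩ => ⟨fun _ => y, hy⟩⟩

lemma all {Q : (α → ℝ) → ℝ → Prop}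
    (hQ : DefPred d fun w : Option α → ℝ => Q (fun i => w (some i)) (w none)) :
    DefPred d fun v => ∀ y, Q v y :=
  (ex (Q := fun v y => ¬Q v y) hQ.not).not.congr fun _ => by simp

lemma const (p : Prop) : DefPred d fun _ : α → ℝ => p := by
  let := rStruc d
  by_cases hp : p
  · exact DefPred.congr (P := fun _ => True) Set.definable_univ fun _ => by simp [hp]
  · exact DefPred.congr (P := fun _ => False) Set.definable_empty fun _ => by simp [hp]

lemma exFinset {ι : Type} {s : Finset ι} {Q : (α → ℝ) → ι → Prop}
    (hQ : ∀ i, DefPred d fun v => Q v i) : DefPred d fun v => ∃ i ∈ s, Q v i := by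
  let := rStruc d
  refine DefPred.congr (P := fun v => v ∈ ⋃ i ∈ s, {v | Q v i})
    (Set.definable_biUnion_finset hQ s) fun v => ?_
  simp

end DefPred

lemma defPred_relMap₁ (R : rLang.Relations 1) (i : α) :
    DefPred d fun v : α → ℝ => (rStruc d).RelMap R ![v i] :=
  let := rStruc d
  Set.empty_definable_iff.2 ⟨R.formula₁ (.var i), by
    ext v
    rw [Set.mem_ofPred_eq, Set.mem_ofPred_eq, FirstOrder.Language.Formula.realize_rel₁]
    rfl⟩

lemma defPred_relMap₂ (R : rLang.Relations 2) (i j : α) :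
    DefPred d fun v : α → ℝ => (rStruc d).RelMap R ![v i, v j] :=
  let := rStruc d
  Set.empty_definable_iff.2 ⟨R.formula₂ (.var i) (.var j), by
    ext v
    rw [Set.mem_ofPred_eq, Set.mem_ofPred_eq, FirstOrder.Language.Formula.realize_rel₂]
    rfl⟩

lemma defPred_eq_funMap₂ (F : rLang.Functions 2) (i j k : α) :
    DefPred d fun v : α → ℝ => v i = (rStruc d).funMap F ![v j, v k] :=
  let := rStruc d
  Set.empty_definable_iff.2
    ⟨(FirstOrder.Language.Term.var i).equal (F.apply₂ (.var j) (.var k)), by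
      ext v
      rw [Set.mem_ofPred_eq, Set.mem_ofPred_eq, FirstOrder.Language.Formula.realize_equal,
        FirstOrder.Language.Term.realize_functions_apply₂]
      rfl⟩

lemma defPred_var_lt (i j : α) : DefPred d fun v : α → ℝ => v i < v j :=
  (defPred_relMap₂ (show rLang.Relations 2 from ()) i j).congr fun _ => Iff.rfl

lemma defPred_var_eq_add (i j k : α) : DefPred d fun v : α → ℝ => v i = v j + v k :=
  (defPred_eq_funMap₂ (show rLang.Functions 2 from ()) i j k).congr fun _ => Iff.rfl

/-- Membership in the group of integer multiples of `c`. -/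
def IsIntMultiple (c x : ℝ) : Prop := ∃ z : ℤ, x = z * c

lemma defPred_var_isIntMultiple_one (i : α) :
    DefPred d fun v : α → ℝ => IsIntMultiple 1 (v i) :=
  (defPred_relMap₁ (show rLang.Relations 1 from false) i).congr fun v => by
    change (∃ z : ℤ, v i = z) ↔ ∃ z : ℤ, v i = z * 1
    simp

lemma defPred_var_isIntMultiple_sqrt (i : α) :
    DefPred d fun v : α → ℝ => IsIntMultiple (√d) (v i) :=
  (defPred_relMap₁ (show rLang.Relations 1 from true) i).congr fun _ => Iff.rfl

/-- The graph of `f : (α → ℝ) → ℝ` is definable in `R_√d` without parameters. -/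
def DefFun (d : ℚ) (f : (α → ℝ) → ℝ) : Prop :=
  DefPred d fun w : Option α → ℝ => w none = f fun i => w (some i)

lemma DefPred.subst {Q : (α → ℝ) → ℝ → Prop} {f : (α → ℝ) → ℝ} (hf : DefFun d f)
    (hQ : DefPred d fun w : Option α → ℝ => Q (fun i => w (some i)) (w none)) :
    DefPred d fun v => Q v (f v) :=
  (DefPred.ex (Q := fun v y => y = f v ∧ Q v y) (hf.and hQ)).congr fun _ => by simp

lemma DefPred.subst₂ {R : ℝ → ℝ → Prop} {f g : (α → ℝ) → ℝ} (hf : DefFun d f) (hg : DefFun d g)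
    (hR : DefPred d fun w : Fin 2 → ℝ => R (w 0) (w 1)) : DefPred d fun v => R (f v) (g v) :=
  DefPred.subst (Q := fun v x => R x (g v)) hf <|
    DefPred.subst (α := Option α) (Q := fun w y => R (w none) y)
      (f := fun w => g fun i => w (some i))
      (DefPred.reindex (P := fun w : Option α → ℝ => w none = g fun i => w (some i)) hg
        fun o : Option α => o.map some)
      (hR.reindex ![some none, none])

lemma DefPred.isIntMultiple {f : (α → ℝ) → ℝ} {c : ℝ}
    (hc : DefPred d fun w : Unit → ℝ => IsIntMultiple c (w ()))
    (hf : DefFun d f) : DefPred d fun v => IsIntMultiple c (f v) :=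
  DefPred.subst (Q := fun _ x => IsIntMultiple c x) hf (hc.reindex fun _ => none)

namespace DefFun

variable {f g : (α → ℝ) → ℝ}

lemma of_iff {Q : (α → ℝ) → ℝ → Prop} (hQf : ∀ v y, Q v y ↔ y = f v)
    (hQ : DefPred d fun w : Option α → ℝ => Q (fun i => w (some i)) (w none)) : DefFun d f :=
  hQ.congr fun _ => hQf _ _

lemma var (i : α) : DefFun d fun v : α → ℝ => v i :=
  ((defPred_var_lt none (some i)).not.and (defPred_var_lt (some i) none).not).congr fun w => by
    rw [not_lt, not_lt, and_comm, ← le_antisymm_iff]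

lemma reindex (hf : DefFun d f) (σ : α → β) : DefFun d fun v : β → ℝ => f fun i => v (σ i) :=
  DefPred.reindex hf (Option.map σ)

lemma add (hf : DefFun d f) (hg : DefFun d g) : DefFun d fun v => f v + g v :=
  DefPred.subst (Q := fun w x => w none = x + g fun i => w (some i)) (hf.reindex some) <|
    DefPred.subst (Q := fun w y => w (some none) = w none + y)
      (hg.reindex fun i => some (some i)) (defPred_var_eq_add _ _ _)

lemma lt (hf : DefFun d f) (hg : DefFun d g) : DefPred d fun v => f v < g v :=
  DefPred.subst₂ hf hg (defPred_var_lt 0 1)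

lemma le (hf : DefFun d f) (hg : DefFun d g) : DefPred d fun v => f v ≤ g v :=
  (lt hg hf).not.congr fun _ => not_lt

lemma eq (hf : DefFun d f) (hg : DefFun d g) : DefPred d fun v => f v = g v :=
  ((le hf hg).and (le hg hf)).congr fun _ => le_antisymm_iff.symm

lemma zero : DefFun d fun _ : α → ℝ => 0 :=
  of_iff (Q := fun _ y => y = y + y) (fun _ y => by simp) (defPred_var_eq_add _ _ _)

lemma neg (hf : DefFun d f) : DefFun d fun v => -f v :=
  of_iff (Q := fun v y => y + f v = 0) (fun _ _ => eq_neg_iff_add_eq_zero.symm)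
    (((var none).add (hf.reindex some)).eq zero)

lemma sub (hf : DefFun d f) (hg : DefFun d g) : DefFun d fun v => f v - g v := by
  simpa only [sub_eq_add_neg] using hf.add hg.neg

lemma abs (hf : DefFun d f) : DefFun d fun v => |f v| :=
  of_iff (Q := fun v y => (0 ≤ f v ∧ y = f v) ∨ (f v < 0 ∧ y = -f v))
    (fun v y => by
      rcases le_or_gt 0 (f v) with h | h
      · simp [abs_of_nonneg h, h, h.not_gt]
      · simp [abs_of_neg h, h, h.not_ge])
    (((zero.le (hf.reindex some)).and ((var none).eq (hf.reindex some))).or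
      (((hf.reindex some).lt zero).and ((var none).eq (hf.reindex some).neg)))

lemma intCast_mul (hf : DefFun d f) (z : ℤ) : DefFun d fun v => z * f v := by
  have nat (n : ℕ) : DefFun d fun v => (n : ℝ) * f v := by
    induction n with
    | zero => simpa using zero
    | succ n ih => simpa [add_mul] using ih.add hf
  rcases z.eq_nat_or_neg with ⟨n, rfl | rfl⟩
  · exact nat n
  · simpa using (nat n).neg

lemma const {c : ℝ} (hc : DefPred d fun w : Unit → ℝ => IsIntMultiple c (w ())) (hc0 : 0 < c) :
    DefFun d fun _ : α → ℝ => c := by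
  refine of_iff
    (Q := fun _ y => IsIntMultiple c y ∧ 0 < y ∧ ∀ x, IsIntMultiple c x → 0 < x → y ≤ x)
    (fun _ y => ⟨?_, ?_⟩) ((hc.isIntMultiple (var _)).and ((zero.lt (var _)).and
      ((hc.isIntMultiple (var none)).imp ((zero.lt (var _)).imp ((var _).le (var _)))).all))
  · rintro ⟨⟨z, rfl⟩, hz, h⟩
    have h1 := h c ⟨1, by simp⟩ hc0
    have hz0 : 0 < z := by exact_mod_cast pos_of_mul_pos_left hz hc0.le
    have hz1 : (1 : ℝ) ≤ z := by exact_mod_cast hz0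
    nlinarith
  · rintro rfl
    refine ⟨⟨1, by simp⟩, hc0, ?_⟩
    rintro _ ⟨z, rfl⟩ hz
    have hz0 : 0 < z := by exact_mod_cast pos_of_mul_pos_left hz hc0.le
    have hz1 : (1 : ℝ) ≤ z := by exact_mod_cast hz0
    nlinarith

end DefFun

lemma defPred_isIntMultiple_ratCast :
    DefPred d fun w : Unit → ℝ => IsIntMultiple d (w ()) := by
  refine DefPred.congr (P := fun w : Unit → ℝ => ∃ k, IsIntMultiple 1 k ∧
      ((d.den : ℤ) : ℝ) * w () = (d.num : ℝ) * k)
    (((defPred_var_isIntMultiple_one _).isIntMultiple (.var none)).and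
      (((DefFun.var (some ())).intCast_mul _).eq ((DefFun.var none).intCast_mul _))).ex fun w => ?_
  have hd : (d.den : ℝ) ≠ 0 := by exact_mod_cast d.den_nz
  have he : (d : ℝ) = d.num / d.den := Rat.cast_def d
  constructor
  · rintro ⟨_, ⟨z, rfl⟩, h⟩
    refine ⟨z, ?_⟩
    rw [he]
    field_simp
    push_cast at h
    linarith
  · rintro ⟨z, h⟩
    refine ⟨z, ⟨z, by simp⟩, ?_⟩
    rw [h, he]
    push_cast
    field_simp

end Definability

section Groups

variable {θ c : ℝ}

/-- The property of being consecutive best approximations, for elements `r`, `r'` of `aℤ`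
approximated by elements `p`, `p'` of `bℤ`. -/
def IsGroupNextApprox (a b r p r' p' : ℝ) : Prop :=
  (IsIntMultiple a r ∧ IsIntMultiple b p ∧ IsIntMultiple a r' ∧ IsIntMultiple b p') ∧
    0 < r ∧ r < r' ∧ |r' - p'| < |r - p| ∧
      ∀ s, IsIntMultiple a s → 0 < s → s < r' → ∀ q, IsIntMultiple b q → |r - p| ≤ |s - q|

/-- `s` is the least nonnegative element of `aℤ` within `|r - p|` of `n` modulo `bℤ`. -/
def IsGroupLeastNear (a b n r p s : ℝ) : Prop :=
  IsIntMultiple a s ∧ 0 ≤ s ∧ (∃ m, IsIntMultiple b m ∧ |n - s - m| < |r - p|) ∧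
    ∀ t, IsIntMultiple a t → 0 ≤ t → t < s → ∀ m, IsIntMultiple b m → |r - p| ≤ |n - t - m|

/-- The version of `SameStep` for the steps `s' - s` and `S' - S` between real numbers. -/
def RealSameStep (N : ℤ) (r r' s s' R R' S S' : ℝ) : Prop :=
  ∃ D ∈ Finset.Icc (-N) N, ∃ a ∈ Finset.Icc (-N) N, ∃ b ∈ Finset.Icc (-N) N,
    D ≠ 0 ∧ D * (s' - s) = a * r + b * r' ∧ D * (S' - S) = a * R + b * R'

lemma IsIntMultiple.forall_iff {Q : ℝ → Prop} :
    (∀ x, IsIntMultiple c x → Q x) ↔ ∀ z : ℤ, Q (z * c) :=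
  ⟨fun h z => h _ ⟨z, rfl⟩, fun h _ ⟨z, hz⟩ => hz ▸ h z⟩

lemma IsIntMultiple.exists_iff {Q : ℝ → Prop} :
    (∃ x, IsIntMultiple c x ∧ Q x) ↔ ∃ z : ℤ, Q (z * c) :=
  ⟨fun ⟨_, ⟨z, hz⟩, h⟩ => ⟨z, hz ▸ h⟩, fun ⟨z, h⟩ => ⟨_, ⟨z, rfl⟩, h⟩⟩

lemma abs_mul_mul_sub_mul (hc : 0 < c) (x y : ℝ) : |x * (θ * c) - y * c| = |x * θ - y| * c := by
  rw [← mul_assoc, ← sub_mul, abs_mul, abs_of_pos hc]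

lemma abs_mul_sub_mul_sub_mul (hc : 0 < c) (x y z : ℝ) :
    |x * (θ * c) - y * (θ * c) - z * c| = |(x - y) * θ - z| * c := by
  rw [← sub_mul, abs_mul_mul_sub_mul hc]

lemma isGroupNextApprox_iff (hθ : 0 < θ) (hc : 0 < c) {r p r' p' : ℤ} :
    IsGroupNextApprox (θ * c) c (r * (θ * c)) (p * c) (r' * (θ * c)) (p' * c) ↔
      IsNextApprox θ r p r' p' := by
  have hθc := mul_pos hθ hc
  simp only [IsGroupNextApprox, IsNextApprox, IsIntMultiple.forall_iff, abs_mul_mul_sub_mul hc,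
    mul_lt_mul_iff_left₀ hc, mul_le_mul_iff_left₀ hc, mul_lt_mul_iff_left₀ hθc,
    mul_pos_iff_of_pos_right hθc, Int.cast_pos, Int.cast_lt]
  exact and_iff_right ⟨⟨r, rfl⟩, ⟨p, rfl⟩, ⟨r', rfl⟩, ⟨p', rfl⟩⟩

lemma IsGroupNextApprox.exists_eq {x y x' y' : ℝ} (hθ : 0 < θ) (hc : 0 < c)
    (h : IsGroupNextApprox (θ * c) c x y x' y') : ∃ r p r' p' : ℤ, x = r * (θ * c) ∧ y = p * c ∧
      x' = r' * (θ * c) ∧ y' = p' * c ∧ IsNextApprox θ r p r' p' := by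
  obtain ⟨⟨r, rfl⟩, ⟨p, rfl⟩, ⟨r', rfl⟩, ⟨p', rfl⟩⟩ := h.1
  exact ⟨r, p, r', p', rfl, rfl, rfl, rfl, (isGroupNextApprox_iff hθ hc).1 h⟩

lemma isGroupLeastNear_iff (hθ : 0 < θ) (hc : 0 < c) {n r p s : ℤ} :
    IsGroupLeastNear (θ * c) c (n * (θ * c)) (r * (θ * c)) (p * c) (s * (θ * c)) ↔
      IsLeastNear θ n |r * θ - p| s := by
  have hθc := mul_pos hθ hc
  simp only [IsGroupLeastNear, IsLeastNear, IsIntMultiple.forall_iff, IsIntMultiple.exists_iff,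
    abs_mul_mul_sub_mul hc, abs_mul_sub_mul_sub_mul hc, mul_lt_mul_iff_left₀ hc,
    mul_le_mul_iff_left₀ hc, mul_lt_mul_iff_left₀ hθc, mul_nonneg_iff_of_pos_right hθc,
    Int.cast_nonneg_iff, Int.cast_lt, Int.cast_sub]
  exact and_iff_right ⟨s, rfl⟩

lemma IsGroupLeastNear.exists_eq (hθ : 0 < θ) (hc : 0 < c) {n r p : ℤ} {x : ℝ}
    (h : IsGroupLeastNear (θ * c) c (n * (θ * c)) (r * (θ * c)) (p * c) x) :
    ∃ s : ℤ, x = s * (θ * c) ∧ IsLeastNear θ n |r * θ - p| s := by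
  obtain ⟨s, rfl⟩ := h.1
  exact ⟨s, rfl, (isGroupLeastNear_iff hθ hc).1 h⟩

lemma realSameStep_iff {c c' : ℝ} (hc : c ≠ 0) (hc' : c' ≠ 0) {N r r' s s' R R' S S' : ℤ} :
    RealSameStep N (r * c) (r' * c) (s * c) (s' * c) (R * c') (R' * c') (S * c') (S' * c') ↔
      SameStep N r r' (s' - s) R R' (S' - S) := by
  have key {c : ℝ} (hc : c ≠ 0) (D a b r r' s s' : ℤ) :
      ((D : ℝ) * (s' * c - s * c) = a * (r * c) + b * (r' * c)) ↔
        D * (s' - s) = a * r + b * r' := by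
    rw [← sub_mul, ← mul_assoc, ← mul_assoc, ← mul_assoc, ← add_mul, mul_left_inj' hc]
    exact_mod_cast Iff.rfl
  simp only [RealSameStep, SameStep, key hc, key hc']

lemma forall_isIntMultiple_le_iff (hc : 0 < c) {r : ℤ} (hr : 0 < r) :
    (∀ t, IsIntMultiple c t → 0 < t → r * c ≤ t) ↔ r = 1 := by
  simp only [IsIntMultiple.forall_iff, mul_pos_iff_of_pos_right hc, mul_le_mul_iff_left₀ hc,
    Int.cast_pos, Int.cast_le]
  exact ⟨fun h => le_antisymm (h 1 one_pos) hr, fun h t ht => h ▸ ht⟩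

/-- The approximations of `u` modulo `bℤ` and of `w` modulo `b'ℤ` evolve in the same way. -/
def HasSameSteps (N : ℤ) (a b a' b' u w : ℝ) : Prop :=
  ∀ r p r' p' R P R' P' s s' S S', IsGroupNextApprox a b r p r' p' →
    IsGroupNextApprox a' b' R P R' P' → IsScaledMatch (r - p) (R - P) →
    IsGroupLeastNear a b u r p s → IsGroupLeastNear a b u r' p' s' →
    IsGroupLeastNear a' b' w R P S → IsGroupLeastNear a' b' w R' P' S' →
    RealSameStep N r r' s s' R R' S S' ∧
      ((∀ t, IsIntMultiple a t → 0 < t → r ≤ t) →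
        ∃ i ∈ Finset.Icc (-N) N, s = i * r ∧ S = i * R)

lemma exists_hasSameSteps_iff {C : ℤ} (hθ : Irrational θ) (h1 : 1.5 < θ) (h2 : θ < 2)
    (hC : IsBadlyApprox θ C) (hC0 : 0 ≤ C) : ∃ N : ℤ, ∀ n n' : ℤ, 0 ≤ n → 0 ≤ n' →
      (HasSameSteps N (θ * 1) 1 (θ * θ) θ (n * (θ * 1)) (n' * (θ * θ)) ↔ n = n') := by
  obtain ⟨N, hN⟩ := eq_iff_forall_sameStep hθ h1 h2 hC hC0
  have h0 : 0 < θ := by linarith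
  have h01 : 0 < θ * 1 := by linarith
  have h00 : 0 < θ * θ := mul_pos h0 h0
  have ematch (r p R P : ℤ) : IsScaledMatch (r * (θ * 1) - p * 1) (R * (θ * θ) - P * θ) ↔
      IsScaledMatch (r * θ - p) (θ * (R * θ - P)) := by
    rw [mul_one, mul_one, show R * (θ * θ) - P * θ = θ * (R * θ - P) by ring]
  have einit (N r s S : ℤ) : (∃ i ∈ Finset.Icc (-N) N, (s * (θ * 1) : ℝ) = i * (r * (θ * 1)) ∧
      (S * (θ * θ) : ℝ) = i * (r * (θ * θ))) ↔
      ∃ i ∈ Finset.Icc (-N) N, s = i * r ∧ S = i * r := by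
    simp only [← mul_assoc _ _ (θ * _), mul_left_inj' h01.ne', mul_left_inj' h00.ne']
    exact_mod_cast Iff.rfl
  refine ⟨N, fun n n' hn hn' => ?_⟩
  rw [hN n n' hn hn']
  constructor
  · intro H r p r' p' s s' t t' h hs hs' ht ht'
    have := H _ _ _ _ _ _ _ _ _ _ _ _ ((isGroupNextApprox_iff h0 one_pos).2 h)
      ((isGroupNextApprox_iff h0 h0).2 h)
      ((ematch _ _ _ _).2 ((h.isScaledMatch_iff hθ h1 h2 h).2 ⟨rfl, rfl⟩))
      ((isGroupLeastNear_iff h0 one_pos).2 hs) ((isGroupLeastNear_iff h0 one_pos).2 hs')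
      ((isGroupLeastNear_iff h0 h0).2 ht) ((isGroupLeastNear_iff h0 h0).2 ht')
    rwa [realSameStep_iff h01.ne' h00.ne', forall_isIntMultiple_le_iff h01 h.1, einit] at this
  · intro H r p r' p' R P R' P' s s' t t' hg hg' hm hgs hgs' hgt hgt'
    obtain ⟨r, p, r', p', rfl, rfl, rfl, rfl, h⟩ := hg.exists_eq h0 one_pos
    obtain ⟨R, P, R', P', rfl, rfl, rfl, rfl, h'⟩ := hg'.exists_eq h0 h0
    obtain ⟨rfl, rfl⟩ := (h.isScaledMatch_iff hθ h1 h2 h').1 ((ematch _ _ _ _).1 hm)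
    obtain ⟨rfl, rfl⟩ := h.unique h' h1 h2
    obtain ⟨s, rfl, hs⟩ := hgs.exists_eq h0 one_pos
    obtain ⟨s', rfl, hs'⟩ := hgs'.exists_eq h0 one_pos
    obtain ⟨t, rfl, ht⟩ := hgt.exists_eq h0 h0
    obtain ⟨t', rfl, ht'⟩ := hgt'.exists_eq h0 h0
    rw [realSameStep_iff h01.ne' h00.ne', forall_isIntMultiple_le_iff h01 h.1, einit]
    exact H _ _ _ _ _ _ _ _ h hs hs' ht ht'

end Groups

section Definability

variable {d : ℚ} {α : Type} {a b a' b' : ℝ}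

lemma defPred_isGroupNextApprox (ha : DefPred d fun w : Unit → ℝ => IsIntMultiple a (w ()))
    (hb : DefPred d fun w : Unit → ℝ => IsIntMultiple b (w ())) (r p r' p' : α) :
    DefPred d fun v : α → ℝ => IsGroupNextApprox a b (v r) (v p) (v r') (v p') := by
  unfold IsGroupNextApprox
  repeat' first
    | exact .var _
    | exact .zero
    | exact ha.isIntMultiple (.var _)
    | exact hb.isIntMultiple (.var _)
    | apply DefPred.all
    | apply DefPred.and
    | apply DefPred.imp
    | apply DefFun.lt
    | apply DefFun.le
    | apply DefFun.abs
    | apply DefFun.sub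

lemma defPred_isGroupLeastNear (ha : DefPred d fun w : Unit → ℝ => IsIntMultiple a (w ()))
    (hb : DefPred d fun w : Unit → ℝ => IsIntMultiple b (w ())) (n r p s : α) :
    DefPred d fun v : α → ℝ => IsGroupLeastNear a b (v n) (v r) (v p) (v s) := by
  unfold IsGroupLeastNear
  repeat' first
    | exact .var _
    | exact .zero
    | exact ha.isIntMultiple (.var _)
    | exact hb.isIntMultiple (.var _)
    | apply DefPred.ex
    | apply DefPred.all
    | apply DefPred.and
    | apply DefPred.imp
    | apply DefFun.lt
    | apply DefFun.le
    | apply DefFun.abs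
    | apply DefFun.sub

lemma defPred_realSameStep (N : ℤ) (r r' s s' R R' S S' : α) :
    DefPred d fun v : α → ℝ =>
      RealSameStep N (v r) (v r') (v s) (v s') (v R) (v R') (v S) (v S') :=
  .exFinset fun D => .exFinset fun a => .exFinset fun b => (DefPred.const (D ≠ 0)).and <|
    ((((DefFun.var _).sub (.var _)).intCast_mul D).eq
      (((DefFun.var _).intCast_mul a).add ((DefFun.var _).intCast_mul b))).and
    ((((DefFun.var _).sub (.var _)).intCast_mul D).eq
      (((DefFun.var _).intCast_mul a).add ((DefFun.var _).intCast_mul b)))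

lemma defPred_isScaledMatch {f g : (α → ℝ) → ℝ} (hf : DefFun d f) (hg : DefFun d g) :
    DefPred d fun v => IsScaledMatch (f v) (g v) :=
  ((hf.lt hg).and (hg.lt (hf.add hf))).or ((hg.lt hf).and ((hf.add hf).lt hg))

lemma defPred_hasSameSteps (N : ℤ) (ha : DefPred d fun w : Unit → ℝ => IsIntMultiple a (w ()))
    (hb : DefPred d fun w : Unit → ℝ => IsIntMultiple b (w ()))
    (ha' : DefPred d fun w : Unit → ℝ => IsIntMultiple a' (w ()))
    (hb' : DefPred d fun w : Unit → ℝ => IsIntMultiple b' (w ())) (u w : α) :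
    DefPred d fun v : α → ℝ => HasSameSteps N a b a' b' (v u) (v w) := by
  unfold HasSameSteps
  iterate 12 apply DefPred.all
  refine (defPred_isGroupNextApprox ha hb _ _ _ _).imp <|
    (defPred_isGroupNextApprox ha' hb' _ _ _ _).imp <|
    (defPred_isScaledMatch ((DefFun.var _).sub (.var _)) ((DefFun.var _).sub (.var _))).imp <|
    (defPred_isGroupLeastNear ha hb _ _ _ _).imp <|
    (defPred_isGroupLeastNear ha hb _ _ _ _).imp <|
    (defPred_isGroupLeastNear ha' hb' _ _ _ _).imp <|
    (defPred_isGroupLeastNear ha' hb' _ _ _ _).imp <|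
    (defPred_realSameStep N _ _ _ _ _ _ _ _).and <| DefPred.imp ?_ ?_
  · exact ((ha.isIntMultiple (.var none)).imp
      ((DefFun.zero.lt (.var _)).imp ((DefFun.var _).le (.var _)))).all
  · exact .exFinset fun i => ((DefFun.var _).eq ((DefFun.var _).intCast_mul i)).and
      ((DefFun.var _).eq ((DefFun.var _).intCast_mul i))

/-- The pairs of representatives, in intervals of length `b` and `b'`, of elements `u` modulo `bℤ`
and `w` modulo `b'ℤ` with the same steps form a definable set. -/
lemma defPred_exists_hasSameSteps (N : ℤ)
    (ha : DefPred d fun w : Unit → ℝ => IsIntMultiple a (w ()))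
    (hb : DefPred d fun w : Unit → ℝ => IsIntMultiple b (w ()))
    (ha' : DefPred d fun w : Unit → ℝ => IsIntMultiple a' (w ()))
    (hb' : DefPred d fun w : Unit → ℝ => IsIntMultiple b' (w ()))
    (hpa : 0 < a) (hpb : 0 < b) (hpa' : 0 < a') (hpb' : 0 < b') :
    DefPred d fun x : Fin 2 → ℝ => ∃ u m w q, IsIntMultiple a u ∧ IsIntMultiple b m ∧
      IsIntMultiple a' w ∧ IsIntMultiple b' q ∧ 0 ≤ u ∧ 0 ≤ w ∧ HasSameSteps N a b a' b' u w ∧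
      x 0 = u - m ∧ b - a < x 0 ∧ x 0 < b + b - a ∧
      x 1 = w - q ∧ b' - a' < x 1 ∧ x 1 < b' + b' - a' := by
  iterate 4 apply DefPred.ex
  refine (ha.isIntMultiple (.var _)).and <| (hb.isIntMultiple (.var _)).and <|
    (ha'.isIntMultiple (.var _)).and <| (hb'.isIntMultiple (.var _)).and <|
    (DefFun.zero.le (.var _)).and <| (DefFun.zero.le (.var _)).and <|
    (defPred_hasSameSteps N ha hb ha' hb' _ _).and <|
    ((DefFun.var _).eq ((DefFun.var _).sub (.var _))).and <| .and ?_ <| .and ?_ <|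
    ((DefFun.var _).eq ((DefFun.var _).sub (.var _))).and <| .and ?_ ?_
  · exact ((DefFun.const hb hpb).sub (.const ha hpa)).lt (.var _)
  · exact (DefFun.var _).lt (((DefFun.const hb hpb).add (.const hb hpb)).sub (.const ha hpa))
  · exact ((DefFun.const hb' hpb').sub (.const ha' hpa')).lt (.var _)
  · exact (DefFun.var _).lt
      (((DefFun.const hb' hpb').add (.const hb' hpb')).sub (.const ha' hpa'))

end Definability

lemma isBadlyApprox_sqrt {d : ℚ} (h0 : 1 ≤ √d) (h2 : √d < 2) (hirr : Irrational √d) :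
    IsBadlyApprox √d (5 * d.den) := by
  intro r p hr hlt
  have hd0 : (0 : ℝ) ≤ d := (Real.sqrt_pos.1 (by linarith)).le
  have hsq : √d * √d = d := Real.mul_self_sqrt hd0
  have hden : (0 : ℝ) < d.den := by exact_mod_cast d.den_pos
  have hr1 : (1 : ℝ) ≤ r := by exact_mod_cast hr
  have hprod : (d.den : ℝ) * ((r * √d - p) * (r * √d + p)) =
      ((r ^ 2 * d.num - d.den * p ^ 2 : ℤ) : ℝ) := by
    have : (d.den : ℝ) * d = d.num := by exact_mod_cast Rat.den_mul_eq_num d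
    push_cast
    linear_combination (d.den * r ^ 2 : ℝ) * hsq + (r ^ 2 : ℝ) * this
  have hne : (r ^ 2 * d.num - d.den * p ^ 2 : ℤ) ≠ 0 := by
    intro h
    rw [h, Int.cast_zero, mul_eq_zero, mul_eq_zero] at hprod
    rcases hprod with h | h | h
    · exact hden.ne' h
    · exact hirr.int_mul_sub_int_ne_zero hr.ne' p h
    · refine hirr.int_mul_sub_int_ne_zero hr.ne' (-p) ?_
      push_cast
      linarith
  have hone : (1 : ℝ) ≤ |((r ^ 2 * d.num - d.den * p ^ 2 : ℤ) : ℝ)| := by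
    exact_mod_cast Int.one_le_abs hne
  rw [← hprod, abs_mul, abs_mul, abs_of_pos hden] at hone
  have hplus : |r * √d + p| ≤ 5 * r := by
    rw [abs_lt] at hlt
    rw [abs_le]
    constructor <;> nlinarith
  calc (1 : ℝ) ≤ d.den * (|r * √d - p| * |r * √d + p|) := hone
    _ ≤ d.den * (|r * √d - p| * (5 * r)) := by gcongr
    _ = _ := by push_cast; ring

theorem lambda_sqrt_d_definable_on_image_f (d : ℚ)
    (h1 : 1.5 < Real.sqrt d) (h2 : Real.sqrt d < 2) (hirr : Irrational (Real.sqrt d)) :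
    letI := rStruc d
    Set.Definable₂ (∅ : Set ℝ) rLang
      {p : ℝ × ℝ | ∃ (n : ℕ) (b : ℕ → ℕ), IsOstrowskiRep (Real.sqrt d) b n ∧
        p.1 = ∑' k : ℕ, (b k : ℝ) * cfBeta (Real.sqrt d) k ∧
        p.2 = Real.sqrt d * p.1} := by
  change DefPred d fun x : Fin 2 → ℝ => ∃ (n : ℕ) (b : ℕ → ℕ), IsOstrowskiRep (√d) b n ∧
    x 0 = ∑' k : ℕ, (b k : ℝ) * cfBeta (√d) k ∧ x 1 = √d * x 0
  have h0 : 0 < √(d : ℝ) := by linarith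
  have hsq : √(d : ℝ) * √(d : ℝ) = d := Real.mul_self_sqrt (Real.sqrt_pos.1 h0).le
  have hA : cfA (√d) 0 = 1 := by
    change ⌊√(d : ℝ)⌋ = 1
    rw [Int.floor_eq_iff]
    constructor <;> push_cast <;> linarith
  obtain ⟨N, hN⟩ := exists_hasSameSteps_iff hirr h1 h2
    (isBadlyApprox_sqrt (by linarith) h2 hirr) (by positivity)
  have hone : DefPred d fun w : Unit → ℝ => IsIntMultiple 1 (w ()) :=
    defPred_var_isIntMultiple_one ()
  have hsqrt : DefPred d fun w : Unit → ℝ => IsIntMultiple (√d) (w ()) :=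
    defPred_var_isIntMultiple_sqrt ()
  have hrat : DefPred d fun w : Unit → ℝ => IsIntMultiple (√d * √d) (w ()) := by
    rw [hsq]
    exact defPred_isIntMultiple_ratCast
  have hsqrt' : DefPred d fun w : Unit → ℝ => IsIntMultiple (√d * 1) (w ()) := by
    rwa [mul_one]
  refine (defPred_exists_hasSameSteps N hsqrt' hone hrat hsqrt (by rwa [mul_one]) one_pos
    (mul_pos h0 h0) h0).congr fun x => ⟨?_, ?_⟩
  · rintro ⟨_, _, _, _, ⟨n, rfl⟩, ⟨m, rfl⟩, ⟨n', rfl⟩, ⟨q, rfl⟩, hu, hw, hs, hx, hx1, hx2,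
      hy, hy1, hy2⟩
    have hn : 0 ≤ n := by
      rwa [mul_one, mul_nonneg_iff_of_pos_right h0, Int.cast_nonneg_iff] at hu
    have hn' : 0 ≤ n' := by
      rwa [mul_nonneg_iff_of_pos_right (mul_pos h0 h0), Int.cast_nonneg_iff] at hw
    obtain rfl := (hN n n' hn hn').1 hs
    lift n to ℕ using hn
    obtain ⟨b, hb⟩ := exists_isOstrowskiRep hirr n
    obtain ⟨k, hk, hk1, hk2⟩ := hb.exists_tsum_eq hirr
    rw [hA] at hk1 hk2
    have hmk (l : ℤ) (hl1 : 1 - √d < n * √d - l) (hl2 : n * √d - l < 1 + 1 - √d) : l = k := by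
      refine Int.eq_of_abs_sub_lt_half (x := n * √d + √d - 3 / 2) ?_ ?_ <;> push_cast at * <;>
        rw [abs_lt] <;> constructor <;> linarith
    push_cast at hx hy
    rw [mul_one, mul_one] at hx
    rw [mul_one] at hx1 hx2
    have hqm : √d * (n * √d - q) = x 1 := by linarith
    obtain rfl := hmk m (hx ▸ hx1) (hx ▸ hx2)
    obtain rfl := hmk q (lt_of_mul_lt_mul_left (by linarith) h0.le)
      (lt_of_mul_lt_mul_left (by linarith) h0.le)
    exact ⟨n, b, hb, by rw [hk, hx], by rw [← hqm, hx]⟩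
  · rintro ⟨n, b, hb, hx, hy⟩
    obtain ⟨k, hk, hk1, hk2⟩ := hb.exists_tsum_eq hirr
    rw [hA, Int.cast_one] at hk1 hk2
    rw [hk] at hx
    have hy1 := mul_lt_mul_of_pos_left hk1 h0
    have hy2 := mul_lt_mul_of_pos_left hk2 h0
    rw [← hx] at hk1 hk2 hy1 hy2
    rw [← hy] at hy1 hy2
    refine ⟨(n : ℤ) * (√d * 1), k * 1, (n : ℤ) * (√d * √d), k * √d, ⟨n, rfl⟩, ⟨k, rfl⟩,
      ⟨n, rfl⟩, ⟨k, rfl⟩, by positivity, by positivity,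
      (hN n n (by positivity) (by positivity)).2 rfl, ?_, ?_, ?_, ?_, ?_, ?_⟩
    · rw [hx]
      push_cast
      ring
    · linarith
    · linarith
    · rw [hy, hx]
      push_cast
      ring
    · linarith
    · linarith
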